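/- arXiv:2005.11189 — 3 statements merged into one kernel-verified Lean document; each statement's English description precedes it below -/
import Mathlib

section
/- For every natural number n ≥ 1, the size of the sufficient cover satisfies n + ∑_{i=1}^{L} 2^i · ⌊n/(2^{i-1}+1)⌋ ≤ (1 + 2·L) · n, where L = ⌈log₂ n⌉ = Nat.clog 2 n and the division is natural-number (floor) division. -/
/-- Each positive-index term of the sufficient cover contributes at most `2 * n`. -/
lemma two_pow_mul_div_le (n : ℕ) {i : ℕ} (hi : 1 ≤ i) :
    2 ^ i * (n / (2 ^ (i - 1) + 1)) ≤ 2 * n := by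
  obtain ⟨k, rfl⟩ := Nat.exists_eq_add_of_le' hi
  rw [Nat.add_sub_cancel]
  calc 2 ^ (k + 1) * (n / (2 ^ k + 1)) = 2 * (2 ^ k * (n / (2 ^ k + 1))) := by ring
    _ ≤ 2 * ((2 ^ k + 1) * (n / (2 ^ k + 1))) := by gcongr; exact Nat.le_succ _
    _ ≤ 2 * n := by gcongr; exact Nat.mul_div_le _ _

/-- The size of the sufficient cover is at most `(1 + 2⌈log₂ n⌉)·n`. -/
theorem sufficient_cover_size_bound (n : ℕ) (hn : 1 ≤ n) :
    n + ∑ i ∈ Finset.Icc 1 (Nat.clog 2 n), 2 ^ i * (n / (2 ^ (i - 1) + 1)) ≤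
      (1 + 2 * Nat.clog 2 n) * n := by
  have h := Finset.sum_le_card_nsmul (Finset.Icc 1 (Nat.clog 2 n)) _ (2 * n)
    fun i hi => two_pow_mul_div_le n (Finset.mem_Icc.mp hi).1
  rw [Nat.card_Icc, Nat.add_sub_cancel, smul_eq_mul] at h
  linarith
end

section
/- Let f : Fin m → ℕ be a family of positive integers (f j ≥ 1 for all j) with ∑ j, f j = n, where n ≥ 1. Then: (1) the number of indices j with f j = 1 is at most n; (2) for every i ≥ 1, the number of indices j with 2^{i-1} < f j ≤ 2^i is at most ⌊n/(2^{i-1}+1)⌋; and (3) every f j satisfies f j ≤ 2^{⌈log₂ n⌉} (with ⌈log₂ n⌉ = Nat.clog 2 n). In other words, the sufficient cover with group sizes s_i = 2^i and multiplicities z_0 = n, z_i = ⌊n/(2^{i-1}+1)⌋ for 1 ≤ i ≤ ⌈log₂ n⌉ accommodates every possible distribution of n ballots among voters. -/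
/-- If every term indexed by `s` is at least `c`, then `s` has at most `(∑ j, f j) / c` elements,
in multiplicative form. -/
theorem card_mul_le_sum_univ {ι : Type*} [Fintype ι] (f : ι → ℕ) (s : Finset ι) (c : ℕ)
    (h : ∀ j ∈ s, c ≤ f j) : s.card * c ≤ ∑ j, f j :=
  (Finset.card_nsmul_le_sum s f c h).trans
    (Finset.sum_le_sum_of_subset (Finset.subset_univ s))

/-- The sufficient cover with sizes `s_i = 2^i` and multiplicities
`z_0 = n`, `z_i = ⌊n/(2^{i−1}+1)⌋` accommodates every distribution of `n` ballots. -/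
theorem sufficient_cover_valid (m n : ℕ) (hn : 1 ≤ n) (f : Fin m → ℕ)
    (hpos : ∀ j, 1 ≤ f j) (hsum : ∑ j, f j = n) :
    (Finset.univ.filter (fun j => f j = 1)).card ≤ n ∧
    (∀ i, 1 ≤ i →
      (Finset.univ.filter (fun j => 2 ^ (i - 1) < f j ∧ f j ≤ 2 ^ i)).card ≤
        n / (2 ^ (i - 1) + 1)) ∧
    (∀ j, f j ≤ 2 ^ Nat.clog 2 n) := by
  subst hsum
  refine ⟨?_, fun i _ => ?_, fun j => ?_⟩
  · simpa using card_mul_le_sum_univ f (Finset.univ.filter (fun j => f j = 1)) 1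
      fun j _ => hpos j
  · rw [Nat.le_div_iff_mul_le (Nat.succ_pos _)]
    exact card_mul_le_sum_univ f _ _ fun j hj => (Finset.mem_filter.mp hj).2.1
  · exact (Finset.single_le_sum (fun _ _ => Nat.zero_le _) (Finset.mem_univ j)).trans
      (Nat.le_pow_clog one_lt_two _)
end

section
/- Let k ≥ 2 and ν ≥ 1 be natural numbers and let n > ν. Define z_0 = ν − 1 and, for i ≥ 1, z_i = min(⌊n/(k^{i-1}+1)⌋, ν_i, ⌊(n−ν)/k^{i-1}⌋), where ν_i = ν if ν · k^i ≥ n and ν_i = ν − 1 otherwise. Then for every family f : Fin ν → ℕ of positive integers (f j ≥ 1 for all j) with ∑ j, f j = n: the number of indices j with f j = 1 is at most z_0, and for every i ≥ 1 the number of indices j with k^{i-1} < f j ≤ k^i is at most z_i. -/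
theorem Finset.card_filter_univ_le_pred {m : ℕ} (p : Fin m → Prop) [DecidablePred p]
    (h : ∃ j, ¬ p j) : (Finset.univ.filter p).card ≤ m - 1 := by
  have hlt : (Finset.univ.filter p).card < (Finset.univ : Finset (Fin m)).card :=
    Finset.card_lt_card (Finset.filter_ssubset.2 (by simpa using h))
  rw [Finset.card_univ, Fintype.card_fin] at hlt
  omega

theorem Finset.card_filter_mul_le_sum {ι : Type*} (s : Finset ι) (p : ι → Prop)
    [DecidablePred p] (g : ι → ℕ) (c : ℕ) (h : ∀ j ∈ s, p j → c ≤ g j) :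
    (s.filter p).card * c ≤ ∑ j ∈ s, g j :=
  calc (s.filter p).card * c ≤ ∑ j ∈ s.filter p, g j := by
        simpa using Finset.card_nsmul_le_sum (s.filter p) g c
          fun j hj => h j (Finset.mem_filter.1 hj).1 (Finset.mem_filter.1 hj).2
    _ ≤ ∑ j ∈ s, g j := Finset.sum_le_sum_of_subset (Finset.filter_subset p s)


/-- The efficient cover with base `k ≥ 2` is valid: for every
distribution of `n > ν` ballots among `ν` voters (each casting at least one ballot),
the number of groups of size 1 is at most `z_0 = ν − 1`, and for every `i ≥ 1` the
number of groups of padded size `k^i` is at most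
`z_i = min(⌊n/(k^{i−1}+1)⌋, ν_i, ⌊(n−ν)/k^{i−1}⌋)` with `ν_i = ν` if `ν·k^i ≥ n`
and `ν_i = ν − 1` otherwise. -/
theorem efficient_cover_valid (k ν n : ℕ) (hk : 2 ≤ k) (hν : 1 ≤ ν) (hn : ν < n)
    (f : Fin ν → ℕ) (hpos : ∀ j, 1 ≤ f j) (hsum : ∑ j, f j = n) :
    (Finset.univ.filter (fun j => f j = 1)).card ≤ ν - 1 ∧
    ∀ i, 1 ≤ i →
      (Finset.univ.filter (fun j => k ^ (i - 1) < f j ∧ f j ≤ k ^ i)).card ≤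
        min (n / (k ^ (i - 1) + 1))
          (min (if n ≤ ν * k ^ i then ν else ν - 1) ((n - ν) / k ^ (i - 1))) := by
  have exists_gt : ∀ c, ν * c < n → ∃ j, c < f j := by
    intro c hc
    by_contra! hle
    have := Finset.sum_le_card_nsmul Finset.univ f c fun j _ => hle j
    simp only [Finset.card_univ, Fintype.card_fin, smul_eq_mul] at this
    exact (hsum ▸ hc).not_ge this
  refine ⟨Finset.card_filter_univ_le_pred _ ?_, fun i _ => le_min ?_ (le_min ?_ ?_)⟩
  · obtain ⟨j, hj⟩ := exists_gt 1 (by simpa using hn)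
    exact ⟨j, hj.ne'⟩
  · rw [Nat.le_div_iff_mul_le (Nat.succ_pos _), ← hsum]
    exact Finset.card_filter_mul_le_sum _ _ f _ fun j _ hj => hj.1
  · split_ifs with h
    · simpa using Finset.card_filter_le (Finset.univ : Finset (Fin ν)) _
    · obtain ⟨j, hj⟩ := exists_gt (k ^ i) (not_le.1 h)
      exact Finset.card_filter_univ_le_pred _ ⟨j, fun hj' => hj'.2.not_gt hj⟩
  · have hexcess : ∑ j, (f j - 1) = n - ν := by
      rw [Finset.sum_tsub_distrib _ fun j _ => hpos j, hsum]
      simp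
    rw [Nat.le_div_iff_mul_le (pow_pos (by omega) _), ← hexcess]
    exact Finset.card_filter_mul_le_sum _ _ _ _ fun j _ hj => Nat.le_sub_one_of_lt hj.1
end
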